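/- Let Σ be a set (alphabet), w ∈ [0,1], and let i : Bool → ℝ be given by i(true) = 1 and i(false) = 0. Let (o₁, δ₁) be a deterministic automaton on X and (o₂, δ₂) one on Y. Let d₁ be a 1-bounded pseudometric on X satisfying max( |i(o₁(x)) − i(o₁(x'))| , w · sup_{a∈Σ} d₁(δ₁(x,a), δ₁(x',a)) ) ≤ d₁(x,x') for all x,x' ∈ X (a bisimulation pseudometric for (o₁,δ₁)), and similarly let d₂ be such a pseudometric on Y for (o₂,δ₂). Define the product automaton by o(x,y) := o₁(x) ∧ o₂(y), δ((x,y),a) := (δ₁(x,a), δ₂(y,a)), and define D((x,y),(x',y')) := max(d₁(x,x'), d₂(y,y')). Then D is a 1-bounded pseudometric on X×Y and max( |i(o(x,y)) − i(o(x',y'))| , w · sup_{a∈Σ} D(δ((x,y),a), δ((x',y'),a)) ) ≤ D((x,y),(x',y')) for all (x,y),(x',y') ∈ X×Y. -/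

import Mathlib

open Set

/-- `d` is a pseudometric: `d x x = 0`, symmetry, and the triangle inequality. -/
def IsPseudometric {X : Type*} (d : X → X → ℝ) : Prop :=
  (∀ x, d x x = 0) ∧ (∀ x y, d x y = d y x) ∧ (∀ x y z, d x z ≤ d x y + d y z)

/-- `d` is 1-bounded: all values are at most `1`. -/
def IsBounded1 {X : Type*} (d : X → X → ℝ) : Prop := ∀ x y, d x y ≤ 1

/-- The cast `i : Bool → ℝ` with `i true = 1`, `i false = 0`. -/
def iB : Bool → ℝ := fun b => if b then 1 else 0

theorem IsPseudometric.nonneg {X : Type*} {d : X → X → ℝ} (hd : IsPseudometric d) (x y : X) :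
    0 ≤ d x y := by
  obtain ⟨h0, hsymm, htri⟩ := hd
  linarith [h0 x, hsymm x y, htri x y x]

theorem IsPseudometric.sup_prod {X Y : Type*} {d₁ : X → X → ℝ} {d₂ : Y → Y → ℝ}
    (hd₁ : IsPseudometric d₁) (hd₂ : IsPseudometric d₂) :
    IsPseudometric (fun p q : X × Y => max (d₁ p.1 q.1) (d₂ p.2 q.2)) := by
  obtain ⟨h0₁, hsymm₁, htri₁⟩ := hd₁
  obtain ⟨h0₂, hsymm₂, htri₂⟩ := hd₂
  refine ⟨fun p => ?_, fun p q => ?_, fun p q r => max_le ?_ ?_⟩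
  · simp only [h0₁, h0₂, max_self]
  · simp only [hsymm₁ p.1, hsymm₂ p.2]
  · exact (htri₁ _ q.1 _).trans (add_le_add (le_max_left _ _) (le_max_left _ _))
  · exact (htri₂ _ q.2 _).trans (add_le_add (le_max_right _ _) (le_max_right _ _))

theorem abs_iB_and_sub_le (a b a' b' : Bool) :
    |iB (a && b) - iB (a' && b')| ≤ max |iB a - iB a'| |iB b - iB b'| := by
  cases a <;> cases b <;> cases a' <;> cases b' <;> simp [iB]

theorem sSup_range_max_le {A : Type*} {f g : A → ℝ} {B C : ℝ} (hf0 : ∀ a, 0 ≤ f a)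
    (hf : ∀ a, f a ≤ B) (hg : ∀ a, g a ≤ C) :
    sSup (Set.range fun a => max (f a) (g a)) ≤ max (sSup (Set.range f)) (sSup (Set.range g)) := by
  refine Real.sSup_le ?_ (le_max_of_le_left (Real.sSup_nonneg (Set.forall_mem_range.2 hf0)))
  rintro _ ⟨a, rfl⟩
  exact max_le_max (le_csSup ⟨B, Set.forall_mem_range.2 hf⟩ ⟨a, rfl⟩)
    (le_csSup ⟨C, Set.forall_mem_range.2 hg⟩ ⟨a, rfl⟩)

-- Note: in Mathlib, `sSup ∅ = 0` for `ℝ`, matching the convention that the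
-- supremum over an empty alphabet is `0`.
theorem statement_16 {X Y A : Type*} (w : ℝ) (hw : w ∈ Icc (0:ℝ) 1)
    (o₁ : X → Bool) (δ₁ : X → A → X) (o₂ : Y → Bool) (δ₂ : Y → A → Y)
    (d₁ : X → X → ℝ) (hd₁ : IsPseudometric d₁) (hb₁ : IsBounded1 d₁)
    (d₂ : Y → Y → ℝ) (hd₂ : IsPseudometric d₂) (hb₂ : IsBounded1 d₂)
    -- d₁ is a bisimulation pseudometric for (o₁, δ₁)
    (hbis₁ : ∀ x x', max |iB (o₁ x) - iB (o₁ x')|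
        (w * sSup (Set.range fun a => d₁ (δ₁ x a) (δ₁ x' a))) ≤ d₁ x x')
    -- d₂ is a bisimulation pseudometric for (o₂, δ₂)
    (hbis₂ : ∀ y y', max |iB (o₂ y) - iB (o₂ y')|
        (w * sSup (Set.range fun a => d₂ (δ₂ y a) (δ₂ y' a))) ≤ d₂ y y') :
    IsPseudometric (fun p q : X × Y => max (d₁ p.1 q.1) (d₂ p.2 q.2)) ∧
    IsBounded1 (fun p q : X × Y => max (d₁ p.1 q.1) (d₂ p.2 q.2)) ∧
    -- max(d₁, d₂) is a bisimulation pseudometric for the product automaton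
    (∀ p q : X × Y,
      max |iB (o₁ p.1 && o₂ p.2) - iB (o₁ q.1 && o₂ q.2)|
        (w * sSup (Set.range fun a =>
          max (d₁ (δ₁ p.1 a) (δ₁ q.1 a)) (d₂ (δ₂ p.2 a) (δ₂ q.2 a)))) ≤
      max (d₁ p.1 q.1) (d₂ p.2 q.2)) := by
  have hD := hd₁.sup_prod hd₂
  refine ⟨hD, fun p q => max_le (hb₁ _ _) (hb₂ _ _), fun p q => ?_⟩
  obtain ⟨ho₁, hs₁⟩ := max_le_iff.1 (hbis₁ p.1 q.1)
  obtain ⟨ho₂, hs₂⟩ := max_le_iff.1 (hbis₂ p.2 q.2)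
  refine max_le ((abs_iB_and_sub_le _ _ _ _).trans (max_le_max ho₁ ho₂)) ?_
  have hsup := sSup_range_max_le (fun a => hd₁.nonneg (δ₁ p.1 a) (δ₁ q.1 a))
    (fun a => hb₁ (δ₁ p.1 a) (δ₁ q.1 a)) (fun a => hb₂ (δ₂ p.2 a) (δ₂ q.2 a))
  refine (mul_le_mul_of_nonneg_left hsup hw.1).trans ?_
  rw [mul_max_of_nonneg _ _ hw.1]
  exact max_le_max hs₁ hs₂
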